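/- arXiv:2003.04006 — 2 statements merged into one kernel-verified Lean document; each statement's English description precedes it below -/
import Mathlib

section
/- Let R be a commutative ring, G a finite group of cardinality n with n invertible in R, and let ρ : G →* (M →ₗ[R] M), σ : G →* (N →ₗ[R] N) be representations of G on R-modules M, N. Define T_M = n • ∑_{g ∈ G} ρ(g) and T_N = n • ∑_{g ∈ G} σ(g). Suppose T_M is bijective on M and n² • id − T_N is bijective on N. Then every G-equivariant R-linear map f : M → N (i.e., f ∘ ρ(g) = σ(g) ∘ f for all g) is zero; likewise every G-equivariant R-linear map N → M is zero. -/
/-- The square of the norm element `∑ g, σ g` is `|G|` times itself. -/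
theorem sum_monoidHom_mul_self {G A : Type*} [Group G] [Fintype G] [Semiring A] (σ : G →* A) :
    (∑ g, σ g) * ∑ g, σ g = Fintype.card G • ∑ g, σ g := by
  have key (g : G) : σ g * ∑ h, σ h = ∑ h, σ h := by
    simp_rw [Finset.mul_sum, ← map_mul]
    exact Fintype.sum_equiv (Equiv.mulLeft g) _ _ fun _ => rfl
  simp [Finset.sum_mul, key]

/-- An equivariant linear map commutes with the scaled norm elements. -/
theorem LinearMap.map_nsmul_sum_of_equivariant {R M N G : Type*} [Semiring R]
    [AddCommMonoid M] [Module R M] [AddCommMonoid N] [Module R N] [Fintype G]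
    {ρ : G → M →ₗ[R] M} {σ : G → N →ₗ[R] N} {f : M →ₗ[R] N}
    (hf : ∀ g, f ∘ₗ ρ g = σ g ∘ₗ f) (n : ℕ) (x : M) :
    f ((n • ∑ g, ρ g) x) = (n • ∑ g, σ g) (f x) := by
  have h (g : G) : f (ρ g x) = σ g (f x) := LinearMap.congr_fun (hf g) x
  simp [LinearMap.sum_apply, h]


/-- Module-category instantiation of Proposition D.5(2): if `T_M = n • ∑ g, ρ g` is bijective on
`M` and `n² • id - T_N` is bijective on `N` (where `n = |G|` is invertible in `R`), then every
`G`-equivariant `R`-linear map `M → N` is zero, and likewise every `G`-equivariant `R`-linear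
map `N → M` is zero. -/
theorem equivariant_maps_between_parts_eq_zero {R M N : Type*} [CommRing R]
    [AddCommGroup M] [Module R M] [AddCommGroup N] [Module R N]
    {G : Type*} [Group G] [Fintype G] [Invertible (Fintype.card G : R)]
    (ρ : G →* (M →ₗ[R] M)) (σ : G →* (N →ₗ[R] N))
    (hTM : Function.Bijective ⇑((Fintype.card G • ∑ g : G, ρ g : M →ₗ[R] M)))
    (hTN : Function.Bijective
      ⇑(((Fintype.card G) ^ 2 • (LinearMap.id : N →ₗ[R] N) -
          Fintype.card G • ∑ g : G, σ g : N →ₗ[R] N))) :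
    (∀ f : M →ₗ[R] N, (∀ g : G, f ∘ₗ ρ g = σ g ∘ₗ f) → f = 0) ∧
    (∀ f : N →ₗ[R] M, (∀ g : G, f ∘ₗ σ g = ρ g ∘ₗ f) → f = 0) := by
  set T : N →ₗ[R] N := Fintype.card G • ∑ g, σ g with hT
  have hsq : T * T = Fintype.card G ^ 2 • T := by
    rw [hT, smul_mul_smul_comm, sum_monoidHom_mul_self, smul_smul, smul_smul]
    congr 1
    ring
  have hzero (y : N) : T y = 0 := by
    apply (injective_iff_map_eq_zero _).1 hTN.1
    have h := LinearMap.congr_fun hsq y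
    simp only [Module.End.mul_apply, LinearMap.smul_apply] at h
    rw [LinearMap.sub_apply, LinearMap.smul_apply, LinearMap.id_apply, h, sub_self]
  refine ⟨fun f hf => LinearMap.ext fun x => ?_, fun f hf => LinearMap.ext fun y => ?_⟩
  · obtain ⟨x, rfl⟩ := hTM.2 x
    rw [LinearMap.map_nsmul_sum_of_equivariant hf]
    exact hzero (f x)
  · apply (injective_iff_map_eq_zero _).1 hTM.1
    rw [← LinearMap.map_nsmul_sum_of_equivariant hf, ← hT, hzero, map_zero]
end

section
/- Let R be a commutative ring, G a finite group of cardinality n with n invertible in R, and ρ : G →* (M →ₗ[R] M) a representation of G on an R-module M. Let M^G := {m ∈ M : ρ(g)(m) = m for all g ∈ G} be the invariants submodule, and let M_G := M ⧸ N be the coinvariants, where N is the submodule of M generated by all elements ρ(g)(m) − m (g ∈ G, m ∈ M). Then the composite of the inclusion M^G ↪ M with the quotient map M ↠ M_G is an R-linear isomorphism. -/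
/-- The norm `∑ g, ρ g` kills the augmentation submodule spanned by the `ρ g m - m`. -/
theorem sum_apply_eq_zero_of_mem_span {R M G : Type*} [CommRing R] [AddCommGroup M] [Module R M]
    [Group G] [Fintype G] (ρ : G →* (M →ₗ[R] M)) {x : M}
    (hx : x ∈ Submodule.span R {x : M | ∃ g : G, ∃ m : M, x = ρ g m - m}) :
    ∑ g, ρ g x = 0 := by
  suffices h : Submodule.span R {x : M | ∃ g : G, ∃ m : M, x = ρ g m - m} ≤
      LinearMap.ker (∑ g, ρ g) by
    simpa using h hx
  rw [Submodule.span_le]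
  rintro _ ⟨g, m, rfl⟩
  have h : ∑ k, ρ k (ρ g m) = ∑ k, ρ k m := by
    simp_rw [← Module.End.mul_apply, ← map_mul]
    exact Equiv.sum_comp (Equiv.mulRight g) fun k => ρ k m
  simp [h]

/-- The norm `∑ g, ρ g m` is fixed by `G`. -/
theorem apply_sum_apply {R M G : Type*} [CommRing R] [AddCommGroup M] [Module R M]
    [Group G] [Fintype G] (ρ : G →* (M →ₗ[R] M)) (g : G) (m : M) :
    ρ g (∑ k, ρ k m) = ∑ k, ρ k m := by
  simp_rw [map_sum, ← Module.End.mul_apply, ← map_mul]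
  exact Equiv.sum_comp (Equiv.mulLeft g) fun k => ρ k m

/-- Module-category instantiation of Corollary D.6: when `|G|` is invertible in `R`, the
composite of the inclusion of the invariants `M^G ↪ M` with the projection onto the
coinvariants `M ↠ M_G = M ⧸ ⟨ρ(g)m - m⟩` is an isomorphism. -/
theorem invariants_to_coinvariants_bijective {R M : Type*} [CommRing R] [AddCommGroup M]
    [Module R M] {G : Type*} [Group G] [Fintype G] [Invertible (Fintype.card G : R)]
    (ρ : G →* (M →ₗ[R] M))
    (MG : Submodule R M) (hMG : ∀ m : M, m ∈ MG ↔ ∀ g : G, ρ g m = m)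
    (Ncoin : Submodule R M)
    (hN : Ncoin = Submodule.span R {x : M | ∃ g : G, ∃ m : M, x = ρ g m - m}) :
    Function.Bijective ⇑(Ncoin.mkQ ∘ₗ MG.subtype) := by
  subst hN
  have hcard (m : M) : ⅟(Fintype.card G : R) • (Fintype.card G • m) = m := by
    rw [← Nat.cast_smul_eq_nsmul R, invOf_smul_smul]
  constructor
  · rw [injective_iff_map_eq_zero]
    rintro ⟨m, hm⟩ h
    have hsum : ∑ g, ρ g m = 0 := sum_apply_eq_zero_of_mem_span ρ (by simpa using h)
    simp only [(hMG m).1 hm, Finset.sum_const, Finset.card_univ] at hsum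
    rw [Submodule.mk_eq_zero, ← hcard m, hsum, smul_zero]
  · intro y
    obtain ⟨m, rfl⟩ := Submodule.mkQ_surjective _ y
    refine ⟨⟨⅟(Fintype.card G : R) • ∑ g, ρ g m,
      (hMG _).2 fun g => by rw [map_smul, apply_sum_apply]⟩, ?_⟩
    have hmk (g : G) : Submodule.mkQ (Submodule.span R
        {x : M | ∃ g : G, ∃ m : M, x = ρ g m - m}) (ρ g m) = Submodule.mkQ _ m :=
      (Submodule.Quotient.eq _).2 (Submodule.subset_span ⟨g, m, rfl⟩)
    rw [LinearMap.comp_apply, Submodule.subtype_apply, map_smul, map_sum,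
      Finset.sum_congr rfl fun g _ => hmk g, Finset.sum_const, Finset.card_univ,
      ← map_nsmul, ← map_smul, hcard]
end
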